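/- arXiv:1810.12115 — 7 statements merged into one kernel-verified Lean document; each statement's English description precedes it below -/
import Mathlib

section
/- For every nonnegative integer n and all integers p and q, the Fibonacci numbers satisfy ∑_{j=0}^{n} C(n,j) · F_p^j · F_{p-1}^{n-j} · F_{j+q} = F_{np+q}. -/
/-- Fibonacci numbers extended to all integer indices:
`F 0 = 0`, `F 1 = 1`, `F n = F (n-1) + F (n-2)` for all `n : ℤ`
(equivalently `F (-n) = (-1)^(n-1) * F n`). -/
def fibZ (n : ℤ) : ℤ :=
  if 0 ≤ n then Nat.fib n.toNat else (-1) ^ (n.natAbs + 1) * Nat.fib n.natAbs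

/-- Lucas numbers extended to all integer indices:
`L 0 = 2`, `L 1 = 1`, `L n = L (n-1) + L (n-2)` for all `n : ℤ`
(equivalently `L (-n) = (-1)^n * L n`). -/
def lucasZ (n : ℤ) : ℤ := fibZ (n - 1) + fibZ (n + 1)

theorem fibZ_eq (n : ℤ) : fibZ n = Int.fib n := by
  unfold fibZ
  split_ifs with h
  · rw [Int.fib_of_nonneg h]
  · obtain ⟨m, rfl⟩ : ∃ m : ℕ, n = -(m : ℤ) := ⟨n.natAbs, by omega⟩
    rw [Int.fib_neg_natCast]
    simp

theorem fib_binomial_sum (n : ℕ) (p q : ℤ) :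
    ∑ j ∈ Finset.range (n + 1),
      (n.choose j : ℤ) * fibZ p ^ j * fibZ (p - 1) ^ (n - j) * fibZ ((j : ℤ) + q)
      = fibZ ((n : ℤ) * p + q) := by
  induction n generalizing q with
  | zero => simp
  | succ n ih =>
    have key := Finset.sum_choose_succ_mul
      (fun i k => fibZ p ^ i * fibZ (p - 1) ^ k * fibZ ((i : ℤ) + q)) n
    have e : fibZ (((n + 1 : ℕ) : ℤ) * p + q)
        = fibZ (p - 1) * fibZ ((n : ℤ) * p + q) + fibZ p * fibZ ((n : ℤ) * p + (q + 1)) := by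
      simp only [fibZ_eq]
      rw [← add_assoc, ← Int.fib_add]
      congr 1
      push_cast
      ring
    rw [e, ← ih q, ← ih (q + 1), Finset.mul_sum, Finset.mul_sum]
    simp only [← mul_assoc] at key
    rw [key]
    congr 1 <;> refine Finset.sum_congr rfl fun j hj => ?_
    · have h : n + 1 - j = (n - j) + 1 := by
        have := Finset.mem_range.1 hj
        omega
      rw [h, pow_succ]
      ring
    · have h : ((j + 1 : ℕ) : ℤ) + q = (j : ℤ) + (q + 1) := by
        push_cast
        ring
      rw [h, pow_succ]
      ring
end

section
/- For every nonnegative integer n and all integers p and q with p ≠ 0, one has (L_p - 1 + (-1)^{p-1}) · ∑_{j=0}^{n} F_{pj+q} = F_p · (F_{pn+p+q-1} - F_{q-1}) - (F_{p-1} - 1) · (F_{pn+p+q} - F_q). -/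
theorem cassini_unit (p : ℤ) : (((-1 : ℤˣ) ^ (p - 1) : ℤˣ) : ℤ)
    = Int.fib p ^ 2 - Int.fib (p - 1) ^ 2 - Int.fib (p - 1) * Int.fib p := by
  have h := Int.fib_succ_mul_fib_pred_sub_fib_sq p
  have h2 := Int.fib_add_two (p - 1)
  rw [show p - 1 + 2 = p + 1 by ring, show p - 1 + 1 = p by ring] at h2
  rw [h2] at h
  rcases Int.even_or_odd p with hp | hp
  · have hq : Odd (p - 1) := by grind
    rw [hq.neg_one_zpow]
    rw [Even.neg_one_pow (Int.natAbs_even.2 hp)] at h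
    push_cast
    linarith
  · have hq : Even (p - 1) := by grind
    rw [hq.neg_one_zpow]
    rw [Odd.neg_one_pow (Int.natAbs_odd.2 hp)] at h
    push_cast
    linarith

theorem fib_step (p m : ℤ) :
    (lucasZ p - 1 + (((-1 : ℤˣ) ^ (p - 1) : ℤˣ) : ℤ)) * fibZ m
      = fibZ p * (fibZ (m + p - 1) - fibZ (m - 1))
        - (fibZ (p - 1) - 1) * (fibZ (m + p) - fibZ m) := by
  rw [cassini_unit, lucasZ]
  simp only [fibZ_eq]
  have h1 := Int.fib_add p m
  have h2 := Int.fib_add p (m - 1)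
  have h3 := Int.fib_add_two (p - 1)
  have h4 := Int.fib_add_two (m - 1)
  rw [show p - 1 + 2 = p + 1 by ring, show p - 1 + 1 = p by ring] at h3
  rw [show m - 1 + 2 = m + 1 by ring, show m - 1 + 1 = m by ring] at h4
  rw [show p + (m - 1) = m + p - 1 by ring, show m - 1 + 1 = m by ring] at h2
  rw [show p + m = m + p by ring] at h1
  rw [h1, h2, h3, h4]
  ring

theorem fib_arith_prog_sum (n : ℕ) (p q : ℤ) (hp : p ≠ 0) :
    (lucasZ p - 1 + (((-1 : ℤˣ) ^ (p - 1) : ℤˣ) : ℤ)) *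
        ∑ j ∈ Finset.range (n + 1), fibZ (p * (j : ℤ) + q)
      = fibZ p * (fibZ (p * (n : ℤ) + p + q - 1) - fibZ (q - 1))
        - (fibZ (p - 1) - 1) * (fibZ (p * (n : ℤ) + p + q) - fibZ q) := by
  clear hp
  induction n with
  | zero =>
    have h := fib_step p q
    simp only [zero_add, Finset.sum_range_one, Nat.cast_zero, mul_zero]
    rw [h, add_comm q p]
  | succ k ih =>
    rw [Finset.sum_range_succ, mul_add, ih, fib_step]
    have e : p * ((k + 1 : ℕ) : ℤ) + q = p * (k : ℤ) + p + q := by push_cast; ring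
    have e2 : p * ((k + 1 : ℕ) : ℤ) + p + q = p * (k : ℤ) + p + q + p := by push_cast; ring
    rw [e, e2]
    ring
end

section
/- For every nonnegative integer n and all integers p and q with p ≠ 0, one has (L_p - 1 + (-1)^{p-1}) · ∑_{j=0}^{n} L_{pj+q} = F_p · (L_{pn+p+q-1} - L_{q-1}) - (F_{p-1} - 1) · (L_{pn+p+q} - L_q). -/
theorem fibZ_rec (n : ℤ) : fibZ (n + 1) = fibZ n + fibZ (n - 1) := by
  rcases le_or_gt 1 n with h | h
  · obtain ⟨k, rfl⟩ : ∃ k : ℕ, n = k + 1 := ⟨(n - 1).toNat, by omega⟩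
    have h1 : ((k : ℤ) + 1 + 1).toNat = k + 2 := by omega
    have h2 : ((k : ℤ) + 1).toNat = k + 1 := by omega
    have h3 : ((k : ℤ) + 1 - 1).toNat = k := by omega
    unfold fibZ
    rw [if_pos (by omega), if_pos (by omega), if_pos (by omega), h1, h2, h3, Nat.fib_add_two]
    push_cast
    ring
  · rcases eq_or_lt_of_le (Int.lt_add_one_iff.mp (by simpa using h) : n ≤ 0) with rfl | h0
    · decide
    · rcases eq_or_lt_of_le (by omega : n ≤ -1) with rfl | h1
      · decide
      · obtain ⟨k, rfl⟩ : ∃ k : ℕ, n = -k - 2 := ⟨(-n - 2).toNat, by omega⟩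
        have h1 : (-(k : ℤ) - 2 + 1).natAbs = k + 1 := by omega
        have h2 : (-(k : ℤ) - 2).natAbs = k + 2 := by omega
        have h3 : (-(k : ℤ) - 2 - 1).natAbs = k + 1 + 2 := by omega
        unfold fibZ
        rw [if_neg (by omega), if_neg (by omega), if_neg (by omega), h1, h2, h3,
          Nat.fib_add_two (n := k + 1), Nat.fib_add_two (n := k)]
        push_cast [Nat.fib_add_two]
        ring

theorem lucasZ_rec (n : ℤ) : lucasZ (n + 1) = lucasZ n + lucasZ (n - 1) := by
  unfold lucasZ
  have h1 := fibZ_rec (n + 1)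
  have h2 := fibZ_rec (n - 1)
  rw [show n + 1 - 1 = n by ring] at *
  rw [show n - 1 + 1 = n by ring] at *
  linarith

theorem lucasZ_add (p : ℤ) : ∀ m : ℤ,
    lucasZ (m + p) = fibZ p * lucasZ (m + 1) + fibZ (p - 1) * lucasZ m := by
  induction p using Int.induction_on with
  | zero =>
    intro m
    have h0 : fibZ 0 = 0 := by decide
    have h1 : fibZ (0 - 1) = 1 := by decide
    rw [h0, h1]; simp
  | succ k ih =>
    intro m
    have h := ih (m + 1)
    have e := lucasZ_rec (m + 1)
    rw [show m + ((k : ℤ) + 1) = m + 1 + k by ring, h, e, fibZ_rec k,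
      show m + 1 - 1 = m by ring, show (k : ℤ) + 1 - 1 = k by ring]
    ring
  | pred k ih =>
    intro m
    have h := ih (m - 1)
    have e := lucasZ_rec m
    have f := fibZ_rec (-(k : ℤ) - 1)
    rw [show -(k : ℤ) - 1 + 1 = -k by ring] at f
    rw [show m - 1 + 1 = m by ring] at h
    rw [show m + (-(k : ℤ) - 1) = m - 1 + -k by ring, h, e, f]
    ring

theorem fibZ_cassini (p : ℤ) :
    fibZ p ^ 2 - fibZ (p - 1) * fibZ p - fibZ (p - 1) ^ 2
      = (((-1 : ℤˣ) ^ (p - 1) : ℤˣ) : ℤ) := by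
  induction p using Int.induction_on with
  | zero => decide
  | succ k ih =>
    rw [fibZ_rec k, show (k : ℤ) + 1 - 1 = (k - 1) + 1 by ring, zpow_add_one]
    push_cast
    rw [← ih, show (k : ℤ) - 1 + 1 = k by ring]
    ring
  | pred k ih =>
    have f := fibZ_rec (-(k : ℤ) - 1)
    rw [show -(k : ℤ) - 1 + 1 = -k by ring] at f
    rw [zpow_sub_one]
    push_cast
    rw [← ih, f]
    simp
    ring

theorem lucas_step (p m : ℤ) :
    (lucasZ p - 1 + (((-1 : ℤˣ) ^ (p - 1) : ℤˣ) : ℤ)) * lucasZ m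
      = fibZ p * (lucasZ (m + p - 1) - lucasZ (m - 1))
        - (fibZ (p - 1) - 1) * (lucasZ (m + p) - lucasZ m) := by
  have h1 := lucasZ_add p m
  have h2 := lucasZ_add p (m - 1)
  rw [show m - 1 + p = m + p - 1 by ring, show m - 1 + 1 = m by ring] at h2
  have hl : lucasZ p = fibZ p + 2 * fibZ (p - 1) := by
    unfold lucasZ
    rw [fibZ_rec p]; ring
  rw [← fibZ_cassini, h1, h2, hl, lucasZ_rec m]
  ring

theorem lucas_arith_prog_sum (n : ℕ) (p q : ℤ) (hp : p ≠ 0) :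
    (lucasZ p - 1 + (((-1 : ℤˣ) ^ (p - 1) : ℤˣ) : ℤ)) *
        ∑ j ∈ Finset.range (n + 1), lucasZ (p * (j : ℤ) + q)
      = fibZ p * (lucasZ (p * (n : ℤ) + p + q - 1) - lucasZ (q - 1))
        - (fibZ (p - 1) - 1) * (lucasZ (p * (n : ℤ) + p + q) - lucasZ q) := by
  induction n with
  | zero =>
    have h := lucas_step p q
    simp only [zero_add, Finset.sum_range_one, Nat.cast_zero, mul_zero]
    rw [h, add_comm q p]
  | succ n ih =>
    rw [Finset.sum_range_succ, mul_add, ih, lucas_step]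
    push_cast
    rw [show p * ((n : ℤ) + 1) + q + p = p * (n + 1) + p + q by ring,
      show p * ((n : ℤ) + 1) + q = p * n + p + q by ring]
    ring
end

section
/- Let p and q be integers and let α = (1+√5)/2. For every real number y with |y| < α^{-|p|}, the series ∑_{j=0}^{∞} F_{pj+q} y^j converges, the denominator 1 - L_p y + (-1)^p y^2 is nonzero, and ∑_{j=0}^{∞} F_{pj+q} y^j = (F_q + (-1)^q F_{p-q} y) / (1 - L_p y + (-1)^p y^2). -/
open Real in
lemma fibZ_real (n : ℤ) :
    (fibZ n : ℝ) = (goldenRatio ^ n - goldenConj ^ n) / √5 := by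
  have hpos : ∀ m : ℕ, (Nat.fib m : ℝ) = (goldenRatio ^ m - goldenConj ^ m) / √5 :=
    Real.coe_fib_eq
  unfold fibZ
  split_ifs with h
  · obtain ⟨m, rfl⟩ := Int.eq_ofNat_of_zero_le h
    simp [hpos]
  · obtain ⟨m, hm⟩ := Int.eq_ofNat_of_zero_le (show 0 ≤ -n by omega)
    obtain rfl : n = -(m : ℤ) := by omega
    simp only [Int.natAbs_neg, Int.natAbs_natCast, zpow_neg, zpow_natCast]
    push_cast
    rw [hpos, ← inv_pow, ← inv_pow, inv_goldenRatio, inv_goldenConj,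
      neg_pow goldenConj, neg_pow goldenRatio]
    ring

open Real in
lemma lucasZ_real (n : ℤ) :
    (lucasZ n : ℝ) = goldenRatio ^ n + goldenConj ^ n := by
  have h5 : (√5 : ℝ) ≠ 0 := by positivity
  unfold lucasZ
  push_cast
  rw [fibZ_real, fibZ_real, zpow_sub_one₀ goldenRatio_ne_zero,
    zpow_add_one₀ goldenRatio_ne_zero, zpow_sub_one₀ goldenConj_ne_zero,
    zpow_add_one₀ goldenConj_ne_zero, inv_goldenRatio, inv_goldenConj, ← add_div,
    div_eq_iff h5, ← goldenRatio_sub_goldenConj]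
  ring

open Real in
lemma abs_zpow_bounds (p : ℤ) :
    |goldenRatio ^ p| ≤ goldenRatio ^ |p| ∧ |goldenConj ^ p| ≤ goldenRatio ^ |p| := by
  have h1 := one_lt_goldenRatio.le
  constructor
  · rw [abs_zpow, abs_of_pos goldenRatio_pos]
    exact zpow_le_zpow_right₀ h1 (le_abs_self p)
  · have : |goldenConj| = goldenRatio⁻¹ := by
      rw [inv_goldenRatio, abs_of_neg goldenConj_neg]
    rw [abs_zpow, this, inv_zpow, ← zpow_neg]
    exact zpow_le_zpow_right₀ h1 (neg_le_abs p)

theorem fib_generating_function (p q : ℤ) (y : ℝ)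
    (hy : |y| < ((1 + Real.sqrt 5) / 2) ^ (-|p|)) :
    Summable (fun j : ℕ => (fibZ (p * (j : ℤ) + q) : ℝ) * y ^ j) ∧
    1 - (lucasZ p : ℝ) * y + (-1 : ℝ) ^ p * y ^ 2 ≠ 0 ∧
    ∑' j : ℕ, (fibZ (p * (j : ℤ) + q) : ℝ) * y ^ j
      = ((fibZ q : ℝ) + (-1 : ℝ) ^ q * (fibZ (p - q) : ℝ) * y) /
        (1 - (lucasZ p : ℝ) * y + (-1 : ℝ) ^ p * y ^ 2) := by 
  have hy' : |y| < Real.goldenRatio ^ (-|p|) := hy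
  have hG := Real.goldenRatio_ne_zero
  have hC := Real.goldenConj_ne_zero
  have hpos : 0 < Real.goldenRatio ^ |p| := zpow_pos Real.goldenRatio_pos _
  have hlt : Real.goldenRatio ^ |p| * |y| < 1 := by
    rw [zpow_neg] at hy'
    calc _ < Real.goldenRatio ^ |p| * (Real.goldenRatio ^ |p|)⁻¹ := by gcongr
      _ = 1 := mul_inv_cancel₀ hpos.ne'
  obtain ⟨hA, hB⟩ := abs_zpow_bounds p
  have hAB : ∀ n : ℤ, (-1 : ℝ) ^ n = Real.goldenRatio ^ n * Real.goldenConj ^ n := by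
    intro n
    rw [← mul_zpow, Real.goldenRatio_mul_goldenConj]
  have hA1 : |Real.goldenRatio ^ p * y| < 1 := by
    rw [abs_mul]
    exact (mul_le_mul_of_nonneg_right hA (abs_nonneg y)).trans_lt hlt
  have hB1 : |Real.goldenConj ^ p * y| < 1 := by
    rw [abs_mul]
    exact (mul_le_mul_of_nonneg_right hB (abs_nonneg y)).trans_lt hlt
  have hden : 1 - (lucasZ p : ℝ) * y + (-1 : ℝ) ^ p * y ^ 2
      = (1 - Real.goldenRatio ^ p * y) * (1 - Real.goldenConj ^ p * y) := by
    rw [lucasZ_real, hAB]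
    ring
  have hnA : 1 - Real.goldenRatio ^ p * y ≠ 0 := by
    have := (abs_lt.mp hA1).2
    linarith
  have hnB : 1 - Real.goldenConj ^ p * y ≠ 0 := by
    have := (abs_lt.mp hB1).2
    linarith
  have hsum := (((hasSum_geometric_of_abs_lt_one hA1).mul_left (Real.goldenRatio ^ q)).sub
    ((hasSum_geometric_of_abs_lt_one hB1).mul_left (Real.goldenConj ^ q))).div_const (√5)
  have hfun : (fun j : ℕ => (fibZ (p * (j : ℤ) + q) : ℝ) * y ^ j) = fun j : ℕ =>
      (Real.goldenRatio ^ q * (Real.goldenRatio ^ p * y) ^ j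
        - Real.goldenConj ^ q * (Real.goldenConj ^ p * y) ^ j) / √5 := by
    funext j
    rw [fibZ_real, zpow_add₀ hG, zpow_add₀ hC, zpow_mul, zpow_mul, zpow_natCast, zpow_natCast]
    ring
  have hnum : (-1 : ℝ) ^ q * (fibZ (p - q) : ℝ)
      = (Real.goldenConj ^ q * Real.goldenRatio ^ p
        - Real.goldenRatio ^ q * Real.goldenConj ^ p) / √5 := by
    have h1 := zpow_ne_zero q hG
    have h2 := zpow_ne_zero q hC
    rw [fibZ_real, hAB, zpow_sub₀ hG, zpow_sub₀ hC]
    field_simp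
  rw [hfun, hden]
  refine ⟨hsum.summable, mul_ne_zero hnA hnB, ?_⟩
  rw [hsum.tsum_eq, hnum, fibZ_real]
  have h5 : (√5 : ℝ) ≠ 0 := by positivity
  generalize Real.goldenRatio ^ p = A at *
  generalize Real.goldenConj ^ p = B at *
  generalize Real.goldenRatio ^ q = a at *
  generalize Real.goldenConj ^ q = b at *
  rw [← div_eq_mul_inv, ← div_eq_mul_inv, div_sub_div _ _ hnA hnB, div_mul_eq_mul_div, ← add_div,
    div_right_comm]
  congr 2
  ring
end

section
/- For every positive integer n and all integers k, t and s, the Fibonacci numbers satisfy ∑_{j=0}^{n} (-1)^{tj} C(n,j) · F_k^j · F_t^{n-j} · F_{(s+k)n-(t+k)j} = F_{t+k}^n · F_{sn}. -/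
theorem fibZ_eq_binet (m : ℤ) : (fibZ m : ℝ) =
    (Real.goldenRatio ^ m - Real.goldenConj ^ m) / √5 := by
  rw [← Real.coe_intFib_eq]
  congr 1
  unfold fibZ
  split_ifs with h
  · exact (Int.fib_of_nonneg h).symm
  · obtain ⟨a, rfl⟩ : ∃ a : ℕ, m = -(a : ℤ) := ⟨m.natAbs, by omega⟩
    rw [Int.fib_neg_natCast]
    simp

theorem binom_aux (n : ℕ) (k t s : ℤ) (x A B e F : ℝ) (hx : x ≠ 0)
    (h : x ^ k * B + e * x ^ (-t) * A = F) :
    ∑ j ∈ Finset.range (n + 1), e ^ j * (n.choose j : ℝ) * A ^ j * B ^ (n - j) *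
      x ^ ((s + k) * (n : ℤ) - (t + k) * (j : ℤ)) = F ^ n * x ^ (s * (n : ℤ)) := by
  rw [← h, add_comm (x ^ k * B), add_pow, Finset.sum_mul]
  refine Finset.sum_congr rfl fun j hj => ?_
  have hj' : j ≤ n := by simpa [Nat.lt_succ_iff] using hj
  have : x ^ ((s + k) * (n : ℤ) - (t + k) * (j : ℤ)) =
      (x ^ k) ^ (n - j) * (x ^ (-t)) ^ j * x ^ (s * (n : ℤ)) := by
    rw [← zpow_natCast, ← zpow_natCast, ← zpow_mul, ← zpow_mul, ← zpow_add₀ hx, ← zpow_add₀ hx]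
    congr 1
    push_cast [Nat.cast_sub hj']
    ring
  rw [this, mul_pow, mul_pow, mul_pow]
  ring

theorem fib_binomial_signed_sum (n : ℕ) (hn : 0 < n) (k t s : ℤ) :
    ∑ j ∈ Finset.range (n + 1),
      (((-1 : ℤˣ) ^ (t * (j : ℤ)) : ℤˣ) : ℤ) * (n.choose j : ℤ) * fibZ k ^ j *
        fibZ t ^ (n - j) * fibZ ((s + k) * (n : ℤ) - (t + k) * (j : ℤ))
      = fibZ (t + k) ^ n * fibZ (s * (n : ℤ)) := by
  have hp := Real.goldenRatio_ne_zero
  have hq := Real.goldenConj_ne_zero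
  have e1 : ((-1 : ℝ) ^ t) * Real.goldenRatio ^ (-t) = Real.goldenConj ^ t := by
    rw [← Real.goldenRatio_mul_goldenConj, mul_zpow, zpow_neg]
    field_simp
  have e2 : ((-1 : ℝ) ^ t) * Real.goldenConj ^ (-t) = Real.goldenRatio ^ t := by
    rw [← Real.goldenRatio_mul_goldenConj, mul_zpow, zpow_neg]
    field_simp
  have h1 := binom_aux n k t s Real.goldenRatio (fibZ k) (fibZ t) ((-1) ^ t) (fibZ (t + k)) hp (by
    rw [e1, fibZ_eq_binet, fibZ_eq_binet, fibZ_eq_binet, zpow_add₀ hp, zpow_add₀ hq]; ring)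
  have h2 := binom_aux n k t s Real.goldenConj (fibZ k) (fibZ t) ((-1) ^ t) (fibZ (t + k)) hq (by
    rw [e2, fibZ_eq_binet, fibZ_eq_binet, fibZ_eq_binet, zpow_add₀ hp, zpow_add₀ hq]; ring)
  have key : ((∑ j ∈ Finset.range (n + 1),
      (((-1 : ℤˣ) ^ (t * (j : ℤ)) : ℤˣ) : ℤ) * (n.choose j : ℤ) * fibZ k ^ j *
        fibZ t ^ (n - j) * fibZ ((s + k) * (n : ℤ) - (t + k) * (j : ℤ)) : ℤ) : ℝ)
      = ((fibZ (t + k) ^ n * fibZ (s * (n : ℤ)) : ℤ) : ℝ) := by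
    have hs : ∀ m : ℤ, ((((-1 : ℤˣ) ^ m : ℤˣ) : ℤ) : ℝ) = (-1 : ℝ) ^ m := by
      intro m
      rcases Int.even_or_odd m with hm | hm
      · simp [hm.neg_one_zpow]
      · simp [hm.neg_one_zpow]
    push_cast [hs]
    rw [fibZ_eq_binet (s * (n : ℤ)), mul_div_assoc', mul_sub, ← h1, ← h2,
      ← Finset.sum_sub_distrib, Finset.sum_div]
    refine Finset.sum_congr rfl fun j _ => ?_
    rw [fibZ_eq_binet ((s + k) * (n : ℤ) - (t + k) * (j : ℤ)), zpow_mul, zpow_natCast]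
    ring
  exact_mod_cast key
end

section
/- Let n be a nonnegative integer and let s, k, r and t be integers with r ≥ n. Then the Fibonacci numbers satisfy (-1)^t · ∑_{j=0}^{n} ((2n+1)/(n+j+1)) · C(n+j+1, 2j+1) · (F_{k+t} F_t)^{r-j} · F_k^{2j+1} · F_{r(2s+k)+s-t-(2t+k)j} = F_{k+t}^{r+n+1} F_t^{r-n} F_{s(r+n+1)+(s+k)(r-n)} - F_t^{r+n+1} F_{k+t}^{r-n} F_{(s+k)(r+n+1)+s(r-n)}. (Here ((2n+1)/(n+j+1)) · C(n+j+1, 2j+1) is an integer for 0 ≤ j ≤ n, and the identity is an identity of rational numbers.) -/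
lemma fj_rec (p d z : ℝ) (hz : z ^ 2 = d * z + p) (n : ℕ) :
    z ^ (2 * n + 1) =
      (∑ j ∈ Finset.range (n + 1), ((n + j).choose (2 * j) : ℝ) * p ^ (n - j) * d ^ (2 * j)) * z
      + ∑ j ∈ Finset.range (n + 1),
          ((n + j).choose (2 * j + 1) : ℝ) * p ^ (n - j) * d ^ (2 * j + 1) := by
  induction n with
  | zero => simp
  | succ n ih =>
    have hW : ∑ j ∈ Finset.range (n + 1 + 1),
          ((n + 1 + j).choose (2 * j + 1) : ℝ) * p ^ (n + 1 - j) * d ^ (2 * j + 1)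
        = p * (d * (∑ j ∈ Finset.range (n + 1),
            ((n + j).choose (2 * j) : ℝ) * p ^ (n - j) * d ^ (2 * j))
          + ∑ j ∈ Finset.range (n + 1),
          ((n + j).choose (2 * j + 1) : ℝ) * p ^ (n - j) * d ^ (2 * j + 1)) := by
      rw [Finset.sum_range_succ, Nat.choose_eq_zero_of_lt (by omega), Finset.mul_sum,
        ← Finset.sum_add_distrib, Finset.mul_sum]
      simp only [Nat.cast_zero, zero_mul, add_zero]
      refine Finset.sum_congr rfl fun j hj => ?_
      have hj' : j ≤ n := by simpa [Nat.lt_succ_iff] using hj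
      rw [show n + 1 + j = (n + j) + 1 by ring, Nat.choose_succ_succ,
        show n + 1 - j = (n - j) + 1 by omega]
      push_cast
      ring
    have hT : ∑ j ∈ Finset.range (n + 1 + 1),
          ((n + 1 + j).choose (2 * j) : ℝ) * p ^ (n + 1 - j) * d ^ (2 * j)
        = p * (∑ j ∈ Finset.range (n + 1),
            ((n + j).choose (2 * j) : ℝ) * p ^ (n - j) * d ^ (2 * j))
          + d * (d * (∑ j ∈ Finset.range (n + 1),
            ((n + j).choose (2 * j) : ℝ) * p ^ (n - j) * d ^ (2 * j))
          + ∑ j ∈ Finset.range (n + 1),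
          ((n + j).choose (2 * j + 1) : ℝ) * p ^ (n - j) * d ^ (2 * j + 1)) := by
      have h1 : p * (∑ j ∈ Finset.range (n + 1),
            ((n + j).choose (2 * j) : ℝ) * p ^ (n - j) * d ^ (2 * j))
          = ∑ j ∈ Finset.range (n + 1 + 1),
            ((n + j).choose (2 * j) : ℝ) * p ^ (n + 1 - j) * d ^ (2 * j) := by
        rw [Finset.sum_range_succ _ (n + 1), Nat.choose_eq_zero_of_lt (by omega), Finset.mul_sum]
        simp only [Nat.cast_zero, zero_mul, add_zero]
        refine Finset.sum_congr rfl fun j hj => ?_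
        have hj' : j ≤ n := by simpa [Nat.lt_succ_iff] using hj
        rw [show n + 1 - j = (n - j) + 1 by omega]
        ring
      rw [h1, Finset.sum_range_succ' _ (n + 1), Finset.sum_range_succ' _ (n + 1), Finset.mul_sum,
        ← Finset.sum_add_distrib, Finset.mul_sum]
      rw [add_right_comm (Finset.sum _ _), ← Finset.sum_add_distrib]
      simp only [mul_zero, Nat.choose_zero_right]
      congr 1
      refine Finset.sum_congr rfl fun j _ => ?_
      rw [show n + 1 + (j + 1) = (n + j + 1) + 1 by ring, show n + (j + 1) = n + j + 1 by ring,
        show 2 * (j + 1) = (2 * j + 1) + 1 by ring, Nat.choose_succ_succ (n + j + 1) (2 * j + 1),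
        Nat.choose_succ_succ (n + j) (2 * j), Nat.add_sub_add_right]
      push_cast
      ring
    rw [hW, hT, show 2 * (n + 1) + 1 = (2 * n + 1) + 2 by ring, pow_add, ih, hz]
    generalize (∑ j ∈ Finset.range (n + 1),
            ((n + j).choose (2 * j) : ℝ) * p ^ (n - j) * d ^ (2 * j)) = T
    generalize (∑ j ∈ Finset.range (n + 1),
          ((n + j).choose (2 * j + 1) : ℝ) * p ^ (n - j) * d ^ (2 * j + 1)) = W
    linear_combination (T * d) * hz

lemma fj_coeff (n j : ℕ) :
    ((2 * (n : ℝ) + 1) / ((n : ℝ) + (j : ℝ) + 1)) * ((n + j + 1).choose (2 * j + 1) : ℝ)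
      = ((n + j).choose (2 * j) : ℝ) + 2 * ((n + j).choose (2 * j + 1) : ℝ) := by
  have h := Nat.add_one_mul_choose_eq (n + j) (2 * j)
  have h1 := Nat.choose_succ_succ (n + j) (2 * j)
  have hR : ((n : ℝ) + j + 1) * ((n + j).choose (2 * j) : ℝ)
      = ((n + j + 1).choose (2 * j + 1) : ℝ) * (2 * j + 1) := by exact_mod_cast h
  have hR1 : ((n + j + 1).choose (2 * j + 1) : ℝ)
      = ((n + j).choose (2 * j) : ℝ) + ((n + j).choose (2 * j + 1) : ℝ) := by exact_mod_cast h1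
  have : (n : ℝ) + j + 1 ≠ 0 := by positivity
  field_simp
  rw [hR1] at hR ⊢
  linear_combination hR

lemma fj_jennings (n N : ℕ) (hN : n ≤ N) (x y d : ℝ) (hd : x - y = d) :
    ∑ j ∈ Finset.range (n + 1),
      ((2 * (n : ℝ) + 1) / ((n : ℝ) + (j : ℝ) + 1)) * ((n + j + 1).choose (2 * j + 1) : ℝ) *
        (x * y) ^ (N - j) * d ^ (2 * j + 1)
      = x ^ (N + n + 1) * y ^ (N - n) - y ^ (N + n + 1) * x ^ (N - n) := by
  have hx := fj_rec (x * y) d x (by rw [← hd]; ring) n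
  have hy := fj_rec (x * y) d (-y) (by rw [← hd]; ring) n
  have hodd : (-y) ^ (2 * n + 1) = - y ^ (2 * n + 1) := Odd.neg_pow ⟨n, rfl⟩ y
  rw [hodd] at hy
  obtain ⟨m, rfl⟩ := Nat.exists_eq_add_of_le hN
  have key : x ^ (n + m + n + 1) * y ^ (n + m - n) - y ^ (n + m + n + 1) * x ^ (n + m - n)
      = (x * y) ^ m * (x ^ (2 * n + 1) + - y ^ (2 * n + 1)) := by
    rw [show n + m - n = m by omega]; ring
  rw [key, hx, hy]
  have e : ∀ T W : ℝ, (x * y) ^ m * (T * x + W + (T * -y + W)) = (x * y) ^ m * (d * T + 2 * W) := by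
    intro T W; rw [← hd]; ring
  rw [e, Finset.mul_sum, Finset.mul_sum, ← Finset.sum_add_distrib, Finset.mul_sum]
  refine Finset.sum_congr rfl fun j hj => ?_
  have hj' : j ≤ n := by simpa [Nat.lt_succ_iff] using hj
  rw [fj_coeff n j, show n + m - j = m + (n - j) by omega, pow_add]
  ring

open Real in
lemma fj_binet (m : ℤ) : (fibZ m : ℝ) = (goldenRatio ^ m - goldenConj ^ m) / √5 := by
  unfold fibZ
  split_ifs with h
  · obtain ⟨a, rfl⟩ := Int.eq_ofNat_of_zero_le h
    simp [Real.coe_fib_eq]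
  · obtain ⟨a, rfl⟩ : ∃ a : ℕ, m = -(a : ℤ) := ⟨m.natAbs, by omega⟩
    simp only [Int.natAbs_neg, Int.natAbs_natCast, zpow_neg, zpow_natCast]
    push_cast
    rw [Real.coe_fib_eq, ← inv_pow, ← inv_pow, Real.inv_goldenRatio, Real.inv_goldenConj,
      neg_pow goldenConj, neg_pow goldenRatio, pow_succ]
    ring

/-- the one-root identity -/
lemma fj_root (n N : ℕ) (hN : n ≤ N) (s k t : ℤ) (u v q : ℝ) (huv : u * v = -1)
    (A B C : ℝ) (hA : A = (u ^ (k + t) - v ^ (k + t)) / q) (hB : B = (u ^ t - v ^ t) / q)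
    (hC : C = (u ^ k - v ^ k) / q) :
    (-1 : ℝ) ^ t * ∑ j ∈ Finset.range (n + 1),
      ((2 * (n : ℝ) + 1) / ((n : ℝ) + (j : ℝ) + 1)) * ((n + j + 1).choose (2 * j + 1) : ℝ) *
        (A * B) ^ (N - j) * C ^ (2 * j + 1) *
        u ^ ((N : ℤ) * (2 * s + k) + s - t - (2 * t + k) * (j : ℤ))
      = A ^ (N + n + 1) * B ^ (N - n) * u ^ (s * ((N : ℤ) + n + 1) + (s + k) * ((N : ℤ) - n))
       - B ^ (N + n + 1) * A ^ (N - n) * u ^ ((s + k) * ((N : ℤ) + n + 1) + s * ((N : ℤ) - n)) := by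
  have hu : u ≠ 0 := by rintro rfl; simp at huv
  have hv : v ≠ 0 := by rintro rfl; simp at huv
  have hvt : v ^ t = (-1) ^ t * u ^ (-t) := by
    rw [← huv, mul_zpow, zpow_neg]
    field_simp
  have hd : A * u ^ s - B * u ^ (s + k) = (-1) ^ t * C * u ^ (s - t) := by
    have : (-1 : ℝ) ^ t * C * u ^ (s - t) = C * v ^ t * u ^ s := by
      rw [hvt, sub_eq_add_neg, zpow_add₀ hu]; ring
    rw [this, hA, hB, hC, zpow_add₀ hu, zpow_add₀ hv, zpow_add₀ hu]
    ring
  have h := fj_jennings n N hN _ _ _ hd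
  have hp : ∀ (a : ℤ) (b : ℕ), (u ^ a) ^ b = u ^ (a * b) := fun a b => by
    rw [zpow_mul, zpow_natCast]
  have hs : ∀ j : ℕ, ((-1 : ℝ) ^ t) ^ (2 * j + 1) = (-1) ^ t := by
    intro j
    rw [pow_succ, pow_mul]
    rcases Int.even_or_odd t with ht | ht
    · simp [ht.neg_one_zpow]
    · simp [ht.neg_one_zpow]
  have hc : ((N - n : ℕ) : ℤ) = (N : ℤ) - n := by omega
  have r1 : (A * u ^ s) ^ (N + n + 1) * (B * u ^ (s + k)) ^ (N - n)
      = A ^ (N + n + 1) * B ^ (N - n) * u ^ (s * ((N : ℤ) + n + 1) + (s + k) * ((N : ℤ) - n)) := by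
    rw [mul_pow, mul_pow, hp, hp, zpow_add₀ hu, hc]; push_cast; ring
  have r2 : (B * u ^ (s + k)) ^ (N + n + 1) * (A * u ^ s) ^ (N - n)
      = B ^ (N + n + 1) * A ^ (N - n) * u ^ ((s + k) * ((N : ℤ) + n + 1) + s * ((N : ℤ) - n)) := by
    rw [mul_pow, mul_pow, hp, hp, zpow_add₀ hu, hc]; push_cast; ring
  rw [← r1, ← r2, ← h, Finset.mul_sum]
  refine Finset.sum_congr rfl fun j hj => ?_
  have hj' : j ≤ n := by simpa [Nat.lt_succ_iff] using hj
  have hcj : ((N - j : ℕ) : ℤ) = (N : ℤ) - j := by omega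
  have e : u ^ ((N : ℤ) * (2 * s + k) + s - t - (2 * t + k) * (j : ℤ))
      = u ^ (s * ((N - j : ℕ) : ℤ)) * u ^ ((s + k) * ((N - j : ℕ) : ℤ))
        * u ^ ((s - t) * ((2 * j + 1 : ℕ) : ℤ)) := by
    rw [← zpow_add₀ hu, ← zpow_add₀ hu, hcj]; congr 1; push_cast; ring
  rw [e, ← hp, ← hp, ← hp, mul_pow ((-1) ^ t * C), mul_pow ((-1) ^ t), hs]
  simp only [mul_pow]
  ring

theorem fib_jennings_sum (n : ℕ) (s k r t : ℤ) (hr : (n : ℤ) ≤ r) :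
    (-1 : ℚ) ^ t *
        ∑ j ∈ Finset.range (n + 1),
          ((2 * (n : ℚ) + 1) / ((n : ℚ) + (j : ℚ) + 1)) *
            ((n + j + 1).choose (2 * j + 1) : ℚ) *
            ((fibZ (k + t) * fibZ t : ℤ) : ℚ) ^ (r - (j : ℤ)) *
            (fibZ k : ℚ) ^ (2 * j + 1) *
            (fibZ (r * (2 * s + k) + s - t - (2 * t + k) * (j : ℤ)) : ℚ)
      = (fibZ (k + t) : ℚ) ^ (r + (n : ℤ) + 1) * (fibZ t : ℚ) ^ (r - (n : ℤ)) *
            (fibZ (s * (r + (n : ℤ) + 1) + (s + k) * (r - (n : ℤ))) : ℚ)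
        - (fibZ t : ℚ) ^ (r + (n : ℤ) + 1) * (fibZ (k + t) : ℚ) ^ (r - (n : ℤ)) *
            (fibZ ((s + k) * (r + (n : ℤ) + 1) + s * (r - (n : ℤ))) : ℚ) := by
  obtain ⟨N, rfl⟩ := Int.eq_ofNat_of_zero_le (le_trans (Int.natCast_nonneg n) hr)
  have hN : n ≤ N := by exact_mod_cast hr
  have e1 : ∀ (x : ℚ) (j : ℕ), j ≤ N → x ^ ((N : ℤ) - (j : ℤ)) = x ^ (N - j) := by
    intro x j hj
    rw [← zpow_natCast, Nat.cast_sub hj]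
  have e2 : ∀ x : ℚ, x ^ ((N : ℤ) + (n : ℤ) + 1) = x ^ (N + n + 1) := by
    intro x
    rw [← zpow_natCast]; push_cast; rfl
  rw [e1 _ n hN, e1 _ n hN, e2, e2]
  have e3 : ∀ j ∈ Finset.range (n + 1),
      ((2 * (n : ℚ) + 1) / ((n : ℚ) + (j : ℚ) + 1)) *
            ((n + j + 1).choose (2 * j + 1) : ℚ) *
            ((fibZ (k + t) * fibZ t : ℤ) : ℚ) ^ ((N : ℤ) - (j : ℤ)) *
            (fibZ k : ℚ) ^ (2 * j + 1) *
            (fibZ ((N : ℤ) * (2 * s + k) + s - t - (2 * t + k) * (j : ℤ)) : ℚ)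
      = ((2 * (n : ℚ) + 1) / ((n : ℚ) + (j : ℚ) + 1)) *
            ((n + j + 1).choose (2 * j + 1) : ℚ) *
            ((fibZ (k + t) : ℚ) * (fibZ t : ℚ)) ^ (N - j) *
            (fibZ k : ℚ) ^ (2 * j + 1) *
            (fibZ ((N : ℤ) * (2 * s + k) + s - t - (2 * t + k) * (j : ℤ)) : ℚ) := by
    intro j hj
    have hj' : j ≤ n := by simpa [Nat.lt_succ_iff] using hj
    rw [e1 _ j (hj'.trans hN), Int.cast_mul]
  rw [Finset.sum_congr rfl e3, ← (Rat.cast_injective (α := ℝ)).eq_iff]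
  push_cast
  have h1 := fj_root n N hN s k t Real.goldenRatio Real.goldenConj (√5)
    Real.goldenRatio_mul_goldenConj (fibZ (k + t)) (fibZ t) (fibZ k)
    (fj_binet _) (fj_binet _) (fj_binet _)
  have neg : ∀ m : ℤ, (fibZ m : ℝ) =
      (Real.goldenConj ^ m - Real.goldenRatio ^ m) / (-√5) := by
    intro m
    rw [fj_binet, div_neg, ← neg_div, neg_sub]
  have h2 := fj_root n N hN s k t Real.goldenConj Real.goldenRatio (-√5)
    Real.goldenConj_mul_goldenRatio (fibZ (k + t)) (fibZ t) (fibZ k)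
    (neg _) (neg _) (neg _)
  have hb : ∀ (c : ℝ) (m : ℤ), c * (fibZ m : ℝ)
      = (c * Real.goldenRatio ^ m - c * Real.goldenConj ^ m) / √5 := by
    intro c m; rw [fj_binet]; ring
  simp only [hb _ (_ + (_ + _) * (_ - _)), hb _ (_ + _ * (_ - _)), hb _ (_ - _ - _)]
  rw [← Finset.sum_div, Finset.sum_sub_distrib, mul_div_assoc', mul_sub, h1, h2]
  ring
end

section
/- For every nonnegative integer n and all integers k, s and t, the Fibonacci numbers satisfy (-1)^{nk+t-1} · F_k · ∑_{j=0}^{n} (-1)^{kj} · F_{n(s-k)+s-t+2kj} = F_t · F_{(s+k)(n+1)} - F_{t+(n+1)k} · F_{s(n+1)}. -/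
theorem fibZ_add (m n : ℤ) :
    fibZ (m + n) = fibZ (m - 1) * fibZ n + fibZ m * fibZ (n + 1) := by
  simp only [fibZ_eq]; exact Int.fib_add m n

theorem fibZ_pred (m : ℤ) : fibZ (m - 1) = fibZ (m + 1) - fibZ m := by
  simp only [fibZ_eq]
  have := Int.fib_add_two (m - 1)
  rw [show m - 1 + 2 = m + 1 by ring, show m - 1 + 1 = m by ring] at this
  linarith

/-- The sign `(-1)^x` as an integer. -/
def sgn (x : ℤ) : ℤ := (((-1 : ℤˣ) ^ x : ℤˣ) : ℤ)

theorem sgn_add (x y : ℤ) : sgn (x + y) = sgn x * sgn y := by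
  simp [sgn, zpow_add]

theorem sgn_sq (x : ℤ) : sgn x * sgn x = 1 := by
  unfold sgn
  rw [← Units.val_mul, ← sq, Int.units_sq, Units.val_one]

theorem sgn_one : sgn 1 = -1 := by simp [sgn]

theorem cassini (n : ℤ) : fibZ (n + 1) * fibZ (n - 1) - fibZ n ^ 2 = sgn n := by
  have step : ∀ i : ℤ, fibZ (i + 1 + 1) * fibZ (i + 1 - 1) - fibZ (i + 1) ^ 2
      = - (fibZ (i + 1) * fibZ (i - 1) - fibZ i ^ 2) := by
    intro i
    have h1 := fibZ_pred (i + 1)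
    have h2 := fibZ_pred i
    rw [show i + 1 - 1 = i by ring] at *
    linear_combination (fibZ (i + 1)) * h2 - fibZ i * h1
  have hs : ∀ i : ℤ, sgn (i + 1) = - sgn i := by
    intro i; rw [sgn_add, sgn_one]; ring
  induction n using Int.induction_on with
  | zero => simp [sgn, fibZ]
  | succ i ih => rw [step, hs, ih]
  | pred i ih =>
    have h1 := step (-(i : ℤ) - 1)
    have h2 := hs (-(i : ℤ) - 1)
    rw [show -(i : ℤ) - 1 + 1 = -(i : ℤ) by ring] at *
    linarith

theorem vajda (n i j : ℤ) :
    fibZ (n + i) * fibZ (n + j) - fibZ n * fibZ (n + (i + j)) = sgn n * fibZ i * fibZ j := by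
  have c := cassini n
  have h1 := fibZ_add i (j + 1)
  rw [fibZ_add n i, fibZ_add n j, fibZ_add n (i + j), fibZ_add i j,
    show i + j + 1 = (i + 1) + j by ring, fibZ_add (i + 1) j,
    show i + 1 - 1 = i by ring, ← c, fibZ_pred n, fibZ_pred i]
  ring

theorem sum_aux (n : ℕ) (k b : ℤ) :
    fibZ k * ∑ j ∈ Finset.range (n + 1), sgn (k * (j : ℤ)) * fibZ (b + 2 * k * (j : ℤ))
      = sgn ((n : ℤ) * k) * fibZ (((n : ℤ) + 1) * k) * fibZ (b + n * k) := by
  induction n with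
  | zero => simp [sgn]
  | succ n ih =>
    rw [Finset.sum_range_succ, mul_add, ih]
    have v := vajda k (((n : ℤ) + 1) * k) (b + n * k)
    push_cast
    rw [show k + (((n : ℤ) + 1) * k + (b + n * k)) = b + 2 * k * ((n : ℤ) + 1) by ring,
      show k + ((n : ℤ) + 1) * k = ((n : ℤ) + 1 + 1) * k by ring,
      show k + (b + (n : ℤ) * k) = b + ((n : ℤ) + 1) * k by ring] at v
    rw [show k * ((n : ℤ) + 1) = n * k + k by ring,
      show sgn (((n : ℤ) + 1) * k) = sgn (n * k + k) by congr 1; ring, sgn_add]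
    linear_combination (-sgn (n * k) * sgn k) * v -
      sgn (n * k) * fibZ (((n : ℤ) + 1) * k) * fibZ (b + n * k) * sgn_sq k

theorem fib_telescoping_sum (n : ℕ) (k s t : ℤ) :
    (((-1 : ℤˣ) ^ ((n : ℤ) * k + t - 1) : ℤˣ) : ℤ) * fibZ k *
        ∑ j ∈ Finset.range (n + 1),
          (((-1 : ℤˣ) ^ (k * (j : ℤ)) : ℤˣ) : ℤ) *
            fibZ ((n : ℤ) * (s - k) + s - t + 2 * k * (j : ℤ))
      = fibZ t * fibZ ((s + k) * ((n : ℤ) + 1)) -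
          fibZ (t + ((n : ℤ) + 1) * k) * fibZ (s * ((n : ℤ) + 1)) := by
  have a := sum_aux n k ((n : ℤ) * (s - k) + s - t)
  have v := vajda t (((n : ℤ) + 1) * k) (s * ((n : ℤ) + 1) - t)
  rw [show t + (((n : ℤ) + 1) * k + (s * ((n : ℤ) + 1) - t)) = (s + k) * ((n : ℤ) + 1) by ring,
    show t + (s * ((n : ℤ) + 1) - t) = s * ((n : ℤ) + 1) by ring] at v
  rw [show (n : ℤ) * (s - k) + s - t + n * k = s * ((n : ℤ) + 1) - t by ring] at a
  have e : sgn ((n : ℤ) * k + t - 1) = - (sgn (n * k) * sgn t) := by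
    have := sgn_add ((n : ℤ) * k + t - 1) 1
    rw [sub_add_cancel, sgn_add, sgn_one] at this
    linarith
  have q := sgn_sq ((n : ℤ) * k)
  change sgn ((n : ℤ) * k + t - 1) * fibZ k * ∑ j ∈ Finset.range (n + 1),
    sgn (k * (j : ℤ)) * fibZ ((n : ℤ) * (s - k) + s - t + 2 * k * (j : ℤ)) = _
  rw [mul_assoc, a, e]
  linear_combination v - sgn t * fibZ (((n : ℤ) + 1) * k) *
    fibZ (s * ((n : ℤ) + 1) - t) * q
end
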